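/- arXiv:math/0307343 — 5 statements merged into one kernel-verified Lean document; each statement's English description precedes it below -/
import Mathlib

section
/- For every real α > −1, the linear span of the Laguerre functions {ℓ_n^α : n ∈ ℕ} is dense in the Hilbert space L²((0,∞), x^α dx). -/
open MeasureTheory Set

/-- The Laguerre polynomial `L_n^α(x) = ∑_{k=0}^n Γ(n+α+1)/Γ(k+α+1) · (−x)^k/(k!(n−k)!)`. -/
noncomputable def laguerreL (α : ℝ) (n : ℕ) (x : ℝ) : ℝ :=
  ∑ k ∈ Finset.range (n + 1),
    Real.Gamma (n + α + 1) / Real.Gamma (k + α + 1) * (-x) ^ k /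
      (Nat.factorial k * Nat.factorial (n - k))

/-- The Laguerre function `ℓ_n^α(x) = L_n^α(2x) e^{−x}`. -/
noncomputable def laguerreFun (α : ℝ) (n : ℕ) (x : ℝ) : ℝ :=
  laguerreL α n (2 * x) * Real.exp (-x)

/-- The measure `x^α dx` on `(0,∞)`. -/
noncomputable def laguerreMeasure (α : ℝ) : Measure ℝ :=
  (volume.restrict (Ioi (0 : ℝ))).withDensity fun x => ENNReal.ofReal (x ^ α)

open ProbabilityTheory Filter Topology

/-- Finite measures on `ℝ` with some finite two-sided exponential moment are determined by their
moments. -/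
theorem MeasureTheory.Measure.ext_of_integral_pow_eq {μ ν : Measure ℝ} [IsFiniteMeasure μ]
    [IsFiniteMeasure ν] (hμ : 0 ∈ interior (integrableExpSet id μ))
    (hν : 0 ∈ interior (integrableExpSet id ν))
    (h : ∀ n : ℕ, ∫ x, x ^ n ∂μ = ∫ x, x ^ n ∂ν) : μ = ν := by
  have hmgf : ∀ᶠ t in 𝓝 (0 : ℝ), mgf id μ t = mgf id ν t := by
    have h1 := (hasFPowerSeriesAt_mgf hμ).eventually_hasSum
    have h2 := (hasFPowerSeriesAt_mgf hν).eventually_hasSum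
    filter_upwards [h1, h2] with t ht1 ht2
    simp only [id, zero_mul, Real.exp_zero, mul_one, zero_add, h] at ht1 ht2
    exact ht1.unique ht2
  have hfreq : ∃ᶠ z in 𝓝[≠] (0 : ℂ), complexMGF id μ z = complexMGF id ν z := by
    have htend : Tendsto (fun t : ℝ => (t : ℂ)) (𝓝[≠] 0) (𝓝[≠] 0) := by
      refine tendsto_nhdsWithin_iff.2 ⟨?_, ?_⟩
      · exact (Complex.continuous_ofReal.tendsto' 0 0 Complex.ofReal_zero).mono_left
          nhdsWithin_le_nhds
      · filter_upwards [self_mem_nhdsWithin] with t ht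
        simpa using ht
    refine htend.frequently (Eventually.frequently ?_)
    filter_upwards [nhdsWithin_le_nhds hmgf] with t ht
    rw [complexMGF_ofReal, complexMGF_ofReal, ht]
  have hU : IsPreconnected
      {z : ℂ | z.re ∈ interior (integrableExpSet id μ) ∩ interior (integrableExpSet id ν)} :=
    ((convex_integrableExpSet.interior.inter convex_integrableExpSet.interior).linear_preimage
      Complex.reLm).isPreconnected
  have heq := AnalyticOnNhd.eqOn_of_preconnected_of_frequently_eq
    (analyticOnNhd_complexMGF.mono fun z hz => hz.1)
    (analyticOnNhd_complexMGF.mono fun z hz => hz.2) hU (z₀ := 0) (by simp [hμ, hν]) hfreq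
  refine Measure.ext_of_charFun (funext fun t => ?_)
  rw [← complexMGF_id_mul_I, ← complexMGF_id_mul_I]
  exact heq (by simp [hμ, hν])

/-- A function with finite two-sided exponential moments, all of whose moments vanish,
is zero almost everywhere. -/
theorem ae_eq_zero_of_integral_pow_mul_eq_zero {μ : Measure ℝ} [SigmaFinite μ] {h : ℝ → ℝ}
    {c : ℝ} (hc : 0 < c) (hexp : ∀ t, |t| < c → Integrable (fun x => Real.exp (t * x) * h x) μ)
    (hmom : ∀ n : ℕ, ∫ x, x ^ n * h x ∂μ = 0) : h =ᵐ[μ] 0 := by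
  have h_int : Integrable h μ := by simpa using hexp 0 (by simpa using hc)
  have key (g : ℝ → ℝ) (hg : Integrable g μ) (hgh : ∀ x, |g x| ≤ |h x|) :
      0 ∈ interior (integrableExpSet id (μ.withDensity fun x => ENNReal.ofReal (g x))) := by
    rw [mem_interior_iff_mem_nhds]
    filter_upwards [Metric.ball_mem_nhds (0 : ℝ) hc] with t ht
    have ht' : |t| < c := by simpa using ht
    change Integrable _ _
    rw [integrable_withDensity_iff_integrable_smul₀' hg.aemeasurable.ennreal_ofReal
      (by simp)]
    refine (hexp t ht').mono (AEMeasurable.aestronglyMeasurable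
      (hg.aemeasurable.ennreal_ofReal.ennreal_toReal.smul (by fun_prop))) (ae_of_all _ fun x => ?_)
    simp only [id, smul_eq_mul, norm_mul, Real.norm_eq_abs, ENNReal.toReal_ofReal']
    rw [mul_comm]
    refine mul_le_mul_of_nonneg_left (le_trans ?_ (hgh x)) (abs_nonneg _)
    rw [abs_of_nonneg (le_max_right _ _)]
    exact max_le (le_abs_self _) (abs_nonneg _)
  have hpos := key h h_int fun _ => le_rfl
  have hneg := key (fun x => -h x) h_int.neg fun _ => (abs_neg _).le
  have := isFiniteMeasure_withDensity_ofReal h_int.2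
  have := isFiniteMeasure_withDensity_ofReal h_int.neg.2
  have hEq : (μ.withDensity fun x => ENNReal.ofReal (h x)) =
      μ.withDensity fun x => ENNReal.ofReal (-h x) := by
    refine Measure.ext_of_integral_pow_eq hpos hneg fun n => ?_
    have i1 := integrable_pow_of_mem_interior_integrableExpSet hpos n
    have i2 := integrable_pow_of_mem_interior_integrableExpSet hneg n
    have m1 : AEMeasurable (fun x => ENNReal.ofReal (h x)) μ := h_int.aemeasurable.ennreal_ofReal
    have m2 : AEMeasurable (fun x => ENNReal.ofReal (-h x)) μ :=
      h_int.neg.aemeasurable.ennreal_ofReal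
    rw [integrable_withDensity_iff_integrable_smul₀' m1 (by simp)] at i1
    rw [integrable_withDensity_iff_integrable_smul₀' m2 (by simp)] at i2
    simp only [id] at i1 i2
    rw [integral_withDensity_eq_integral_toReal_smul₀ m1 (by simp),
      integral_withDensity_eq_integral_toReal_smul₀ m2 (by simp), ← sub_eq_zero,
      ← integral_sub i1 i2, ← hmom n]
    refine integral_congr_ae (ae_of_all _ fun x => ?_)
    simp only [ENNReal.toReal_ofReal', smul_eq_mul, ← sub_mul]
    rw [max_zero_sub_max_neg_zero_eq_self, mul_comm]
  have hae := (withDensity_eq_iff h_int.aemeasurable.ennreal_ofReal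
    h_int.neg.aemeasurable.ennreal_ofReal h_int.lintegral_lt_top.ne).1 hEq
  filter_upwards [hae] with x hx
  have hx' := congrArg ENNReal.toReal hx
  simp only [Pi.neg_apply, ENNReal.toReal_ofReal'] at hx'
  rcases le_total (h x) 0 with h0 | h0
  · rw [max_eq_right h0, max_eq_left (by linarith)] at hx'
    simpa using hx'
  · rw [max_eq_left h0, max_eq_right (by linarith)] at hx'
    exact hx'

instance (α : ℝ) : SigmaFinite (laguerreMeasure α) := by
  unfold laguerreMeasure
  infer_instance

theorem memLp_pow_mul_exp_laguerreMeasure {α : ℝ} (hα : -1 < α) (n : ℕ) {b : ℝ} (hb : 0 < b) :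
    MemLp (fun x => x ^ n * Real.exp (-b * x)) 2 (laguerreMeasure α) := by
  rw [memLp_two_iff_integrable_sq (by fun_prop), laguerreMeasure,
    integrable_withDensity_iff_integrable_smul₀' (by fun_prop) (by simp)]
  refine Integrable.congr (integrableOn_rpow_mul_exp_neg_mul_rpow (p := 1) (s := α + (2 * n : ℕ))
    (b := 2 * b) (lt_add_of_lt_of_nonneg hα (Nat.cast_nonneg _)) one_pos (by positivity)) ?_
  filter_upwards [ae_restrict_mem measurableSet_Ioi] with x (hx : 0 < x)
  rw [ENNReal.toReal_ofReal (by positivity), Real.rpow_add_natCast hx.ne', Real.rpow_one,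
    smul_eq_mul, mul_pow, ← Real.exp_nat_mul, pow_mul']
  push_cast
  ring_nf

theorem laguerreFun_eq_sum (α : ℝ) (n : ℕ) (x : ℝ) :
    laguerreFun α n x = ∑ k ∈ Finset.range (n + 1),
      Real.Gamma (n + α + 1) / Real.Gamma (k + α + 1) * (-2) ^ k /
        (Nat.factorial k * Nat.factorial (n - k)) * (x ^ k * Real.exp (-1 * x)) := by
  rw [laguerreFun, laguerreL, Finset.sum_mul]
  refine Finset.sum_congr rfl fun k _ => ?_
  rw [show -(2 * x) = -2 * x by ring, mul_pow, neg_one_mul]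
  ring

theorem memLp_laguerreFun {α : ℝ} (hα : -1 < α) (n : ℕ) :
    MemLp (laguerreFun α n) 2 (laguerreMeasure α) := by
  rw [funext (laguerreFun_eq_sum α n)]
  exact memLp_finsetSum _ fun k _ =>
    (memLp_pow_mul_exp_laguerreMeasure hα k one_pos).const_mul _

/-- Orthogonality to every Laguerre function passes to every `x ^ n * e ^ (-x)`. -/
theorem integral_pow_mul_exp_mul_eq_zero {α : ℝ} (hα : -1 < α) {f : ℝ → ℝ}
    (hf : MemLp f 2 (laguerreMeasure α))
    (h : ∀ n, ∫ x, laguerreFun α n x * f x ∂laguerreMeasure α = 0) (n : ℕ) :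
    ∫ x, x ^ n * Real.exp (-1 * x) * f x ∂laguerreMeasure α = 0 := by
  induction n using Nat.strong_induction_on with
  | _ n ih =>
    have hn := h n
    simp only [laguerreFun_eq_sum, Finset.sum_mul, mul_assoc (_ / _) _ (f _)] at hn
    have h_int (k : ℕ) :
        Integrable (fun x => x ^ k * Real.exp (-1 * x) * f x) (laguerreMeasure α) :=
      (memLp_pow_mul_exp_laguerreMeasure hα k one_pos).integrable_mul hf
    rw [integral_finsetSum _ fun k _ => (h_int k).const_mul _] at hn
    simp only [integral_const_mul] at hn
    rw [Finset.sum_range_succ, Finset.sum_eq_zero, zero_add] at hn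
    · refine (mul_eq_zero.1 hn).resolve_left ?_
      have hG : Real.Gamma (n + α + 1) ≠ 0 :=
        (Real.Gamma_pos_of_pos (by have : (0 : ℝ) ≤ n := n.cast_nonneg
                                   linarith)).ne'
      have := Nat.factorial_ne_zero n
      simp [hG, this]
    · intro k hk
      rw [ih k (Finset.mem_range.1 hk), mul_zero]

theorem laguerreFun_span_dense (α : ℝ) (hα : -1 < α) :
    Dense (Submodule.span ℝ
        {g : Lp ℝ 2 (laguerreMeasure α) |
          ∃ n : ℕ, (g : ℝ → ℝ) =ᵐ[laguerreMeasure α] laguerreFun α n} :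
      Set (Lp ℝ 2 (laguerreMeasure α))) := by
  rw [Submodule.dense_iff_topologicalClosure_eq_top, Submodule.topologicalClosure_eq_top_iff,
    Submodule.eq_bot_iff]
  intro f hf
  have hfL : MemLp f 2 (laguerreMeasure α) := Lp.memLp f
  have horth (n : ℕ) : ∫ x, laguerreFun α n x * f x ∂laguerreMeasure α = 0 := by
    have hae := (memLp_laguerreFun hα n).coeFn_toLp
    have hin := (Submodule.mem_orthogonal _ _).1 hf _ (Submodule.subset_span ⟨n, hae⟩)
    rw [L2.inner_def] at hin
    rw [← hin]
    refine integral_congr_ae ?_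
    filter_upwards [hae] with x hx
    simp [hx, mul_comm]
  have hzero : (fun x => Real.exp (-1 * x) * f x) =ᵐ[laguerreMeasure α] 0 := by
    refine ae_eq_zero_of_integral_pow_mul_eq_zero one_pos (fun t ht => ?_) fun n => ?_
    · refine ((memLp_pow_mul_exp_laguerreMeasure hα 0 (b := 1 - t)
        (by linarith [(abs_lt.1 ht).2])).integrable_mul hfL).congr (ae_of_all _ fun x => ?_)
      simp only [Pi.mul_apply, pow_zero, one_mul, ← mul_assoc, ← Real.exp_add]
      ring_nf
    · simpa only [mul_assoc] using integral_pow_mul_exp_mul_eq_zero hα hfL horth n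
  refine (Lp.eq_zero_iff_ae_eq_zero).2 ?_
  filter_upwards [hzero] with x hx
  exact (mul_eq_zero.1 hx).resolve_left (Real.exp_pos _).ne'
end

section
/- For every real α > −1, every n ∈ ℕ, and every complex number z with Re z > 0, the Laplace transform of the Laguerre function ℓ_n^α is given by ∫₀^∞ e^{−xz} ℓ_n^α(x) x^α dx = [Γ(n+α+1)/Γ(n+1)] · ((z−1)/(z+1))^n · (z+1)^{−(α+1)}, where complex powers are taken with the principal branch (Re(z+1) > 0). -/
open MeasureTheory Set

/-- The integrand of the Laplace transform of `x ^ s` is integrable on the right half-plane. -/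
theorem integrableOn_rpow_mul_cexp_neg_mul {s : ℝ} (hs : -1 < s) {w : ℂ} (hw : 0 < w.re) :
    IntegrableOn (fun x : ℝ => ((x ^ s : ℝ) : ℂ) * Complex.exp (-(x * w))) (Ioi 0) := by
  have hreal : IntegrableOn (fun x : ℝ => x ^ s * Real.exp (-w.re * x)) (Ioi 0) := by
    simpa using integrableOn_rpow_mul_exp_neg_mul_rpow hs one_pos hw
  refine hreal.mono' (by fun_prop) ?_
  filter_upwards [ae_restrict_mem measurableSet_Ioi] with x hx
  have hx' : 0 ≤ x ^ s := Real.rpow_nonneg (le_of_lt hx) s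
  simp [Complex.norm_exp, abs_of_nonneg hx', mul_comm]

theorem differentiableAt_integral_rpow_mul_cexp_neg_mul {s : ℝ} (hs : -1 < s) {w : ℂ}
    (hw : 0 < w.re) :
    DifferentiableAt ℂ
      (fun w : ℂ => ∫ x in Ioi (0 : ℝ), ((x ^ s : ℝ) : ℂ) * Complex.exp (-(x * w))) w := by
  have hU : {v : ℂ | w.re / 2 < v.re} ∈ nhds w :=
    (isOpen_lt continuous_const Complex.continuous_re).mem_nhds (half_lt_self hw)
  have hbound : IntegrableOn (fun x : ℝ => x ^ (s + 1) * Real.exp (-(w.re / 2) * x)) (Ioi 0) := by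
    simpa using integrableOn_rpow_mul_exp_neg_mul_rpow (s := s + 1) (by linarith) one_pos
      (half_pos hw)
  refine (hasDerivAt_integral_of_dominated_loc_of_deriv_le
    (μ := volume.restrict (Ioi 0))
    (F := fun v x => ((x ^ s : ℝ) : ℂ) * Complex.exp (-(x * v)))
    (F' := fun v x => ((x ^ s : ℝ) : ℂ) * (Complex.exp (-(x * v)) * -(x : ℂ))) hU
    (.of_forall fun v => by fun_prop) (integrableOn_rpow_mul_cexp_neg_mul hs hw) (by fun_prop)
    ?_ hbound ?_).2.differentiableAt
  · filter_upwards [ae_restrict_mem measurableSet_Ioi] with x hx v hv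
    have hx0 : 0 < x := hx
    have hv' : w.re / 2 < v.re := hv
    have hx' : 0 ≤ x ^ s := Real.rpow_nonneg hx0.le s
    simp only [norm_mul, Complex.norm_real, Real.norm_eq_abs, norm_neg, Complex.norm_exp,
      Complex.neg_re, Complex.re_ofReal_mul, abs_of_nonneg hx', abs_of_pos hx0,
      Real.rpow_add_one hx0.ne']
    rw [mul_comm (Real.exp _), ← mul_assoc]
    gcongr
    nlinarith
  · refine .of_forall fun x v _ => HasDerivAt.const_mul _ ?_
    simpa using ((hasDerivAt_id v).const_mul (x : ℂ)).neg.cexp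

/-- The Laplace transform of `x ^ s` on the right half-plane. -/
theorem integral_rpow_mul_cexp_neg_mul {s : ℝ} (hs : -1 < s) {w : ℂ} (hw : 0 < w.re) :
    ∫ x in Ioi (0 : ℝ), ((x ^ s : ℝ) : ℂ) * Complex.exp (-(x * w)) =
      (Real.Gamma (s + 1) : ℂ) * w ^ (-((s : ℂ) + 1)) := by
  have hopen : IsOpen {v : ℂ | 0 < v.re} := isOpen_lt continuous_const Complex.continuous_re
  have hF : AnalyticOnNhd ℂ
      (fun w : ℂ => ∫ x in Ioi (0 : ℝ), ((x ^ s : ℝ) : ℂ) * Complex.exp (-(x * w)))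
      {v : ℂ | 0 < v.re} :=
    DifferentiableOn.analyticOnNhd (fun v hv =>
      (differentiableAt_integral_rpow_mul_cexp_neg_mul hs hv).differentiableWithinAt) hopen
  have hG : AnalyticOnNhd ℂ (fun w : ℂ => (Real.Gamma (s + 1) : ℂ) * w ^ (-((s : ℂ) + 1)))
      {v : ℂ | 0 < v.re} :=
    DifferentiableOn.analyticOnNhd (fun v hv =>
      ((differentiableAt_id.cpow_const (.inl hv)).const_mul _).differentiableWithinAt) hopen
  refine hF.eqOn_of_preconnected_of_frequently_eq hG
    (convex_halfSpace_re_gt 0).isPreconnected (z₀ := ((1 : ℝ) : ℂ)) (by simp) ?_ hw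
  have hev : ∀ᶠ r : ℝ in nhdsWithin 1 {1}ᶜ,
      ∫ x in Ioi (0 : ℝ), ((x ^ s : ℝ) : ℂ) * Complex.exp (-(x * (r : ℂ))) =
        (Real.Gamma (s + 1) : ℂ) * (r : ℂ) ^ (-((s : ℂ) + 1)) := by
    filter_upwards [nhdsWithin_le_nhds (lt_mem_nhds one_pos)] with r hr
    have hint := integral_rpow_mul_exp_neg_mul_rpow one_pos hs hr
    simp only [Real.rpow_one, div_one, mul_one] at hint
    have hcast : (r : ℂ) ^ (-((s : ℂ) + 1)) = ((r ^ (-(s + 1)) : ℝ) : ℂ) := by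
      rw [Complex.ofReal_cpow hr.le]
      push_cast
      rfl
    rw [hcast, ← Complex.ofReal_mul, mul_comm, ← hint, ← integral_complex_ofReal]
    refine integral_congr_ae (.of_forall fun x => ?_)
    simp [mul_comm]
  have htend : Filter.Tendsto (fun r : ℝ => (r : ℂ)) (nhdsWithin 1 {1}ᶜ)
      (nhdsWithin ((1 : ℝ) : ℂ) {((1 : ℝ) : ℂ)}ᶜ) :=
    Complex.continuous_ofReal.continuousWithinAt.tendsto_nhdsWithin fun r hr => by
      simpa using hr
  exact htend.frequently hev.frequently

theorem sum_laguerre_coeff_mul_inv_pow (n : ℕ) {z : ℂ} (hz : z + 1 ≠ 0) :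
    ∑ k ∈ Finset.range (n + 1),
        (-2 : ℂ) ^ k / (k.factorial * (n - k).factorial) * ((z + 1) ^ k)⁻¹ =
      ((z - 1) / (z + 1)) ^ n / n.factorial := by
  have hbase : (z - 1) / (z + 1) = -2 / (z + 1) + 1 := by
    field_simp
    ring
  rw [hbase, add_pow, Finset.sum_div]
  refine Finset.sum_congr rfl fun k hk => ?_
  have hk' : k ≤ n := Nat.lt_succ_iff.mp (Finset.mem_range.mp hk)
  have hn : (n.factorial : ℂ) ≠ 0 := by exact_mod_cast n.factorial_ne_zero
  rw [Nat.cast_choose ℂ hk', div_pow, one_pow]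
  field_simp

theorem laguerreFun_laplace_transform (α : ℝ) (hα : -1 < α) (n : ℕ) (z : ℂ)
    (hz : 0 < z.re) :
    ∫ x in Ioi (0 : ℝ),
        Complex.exp (-(x : ℂ) * z) * (laguerreFun α n x : ℂ) * ((x ^ α : ℝ) : ℂ) =
      ((Real.Gamma (n + α + 1) / Real.Gamma (n + 1) : ℝ) : ℂ) *
        ((z - 1) / (z + 1)) ^ n * (z + 1) ^ (-((α : ℂ) + 1)) := by
  have hw : 0 < (z + 1).re := by
    simp only [Complex.add_re, Complex.one_re]
    linarith
  have hw0 : z + 1 ≠ 0 := fun h => by simp [h] at hw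
  have hk1 (k : ℕ) : -1 < (k : ℝ) + α := by
    have := k.cast_nonneg (α := ℝ)
    linarith
  set c : ℕ → ℂ := fun k => ((Real.Gamma (n + α + 1) / Real.Gamma (k + α + 1) * (-2) ^ k /
    (k.factorial * (n - k).factorial) : ℝ) : ℂ) with hc
  have hexpand : ∀ x ∈ Ioi (0 : ℝ),
      Complex.exp (-(x : ℂ) * z) * (laguerreFun α n x : ℂ) * ((x ^ α : ℝ) : ℂ) =
        ∑ k ∈ Finset.range (n + 1),
          c k * (((x ^ ((k : ℝ) + α) : ℝ) : ℂ) * Complex.exp (-(x * (z + 1)))) := by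
    intro x hx
    have hexp : Complex.exp (-(x * (z + 1))) = Complex.exp (-(x : ℂ) * z) * Complex.exp (-x) := by
      rw [← Complex.exp_add]
      ring_nf
    simp only [laguerreFun, laguerreL, hexp, hc, Complex.ofReal_mul, Complex.ofReal_sum,
      Complex.ofReal_exp, Finset.sum_mul, Finset.mul_sum]
    refine Finset.sum_congr rfl fun k _ => ?_
    rw [Real.rpow_add hx, Real.rpow_natCast, show -(2 * x) = -2 * x by ring, mul_pow]
    push_cast
    ring
  rw [setIntegral_congr_fun measurableSet_Ioi hexpand, integral_finsetSum _ fun k _ =>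
    (integrableOn_rpow_mul_cexp_neg_mul (hk1 k) hw).const_mul _]
  have hterm (k : ℕ) : ∫ x in Ioi (0 : ℝ),
      c k * (((x ^ ((k : ℝ) + α) : ℝ) : ℂ) * Complex.exp (-(x * (z + 1)))) =
        Real.Gamma (n + α + 1) * (z + 1) ^ (-((α : ℂ) + 1)) *
          ((-2 : ℂ) ^ k / (k.factorial * (n - k).factorial) * ((z + 1) ^ k)⁻¹) := by
    have hΓ : (Real.Gamma (k + α + 1) : ℂ) ≠ 0 :=
      Complex.ofReal_ne_zero.mpr (Real.Gamma_pos_of_pos (by linarith [hk1 k])).ne'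
    have hpow : (z + 1) ^ (-(((k + α : ℝ) : ℂ) + 1)) =
        (z + 1) ^ (-((α : ℂ) + 1)) * ((z + 1) ^ k)⁻¹ := by
      rw [← Complex.cpow_natCast, ← Complex.cpow_neg, ← Complex.cpow_add _ _ hw0]
      push_cast
      ring_nf
    rw [integral_const_mul, integral_rpow_mul_cexp_neg_mul (hk1 k) hw, hpow, hc]
    push_cast
    field_simp
  simp only [hterm, ← Finset.mul_sum, sum_laguerre_coeff_mul_inv_pow n hw0,
    Real.Gamma_nat_eq_factorial]
  push_cast
  ring
end

section
/- For every real ν > 0, every complex λ, and every integer n ≥ 1, the Taylor coefficients p_{ν,n}(λ) of G_{ν,λ} satisfy the three-term recurrence relation 2iλ · p_{ν,n}(λ) = (n+1) · p_{ν,n+1}(λ) − (ν + n − 1) · p_{ν,n−1}(λ). -/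
/-- `G_{ν,λ}(x) = (1−x²)^{−ν/2} · exp(iλ · log((1+x)/(1−x)))` for real `x` with `|x| < 1`. -/
noncomputable def GFun (ν : ℝ) (lam : ℂ) (x : ℝ) : ℂ :=
  (((1 - x ^ 2) ^ (-ν / 2) : ℝ) : ℂ) *
    Complex.exp (Complex.I * lam * (Real.log ((1 + x) / (1 - x)) : ℝ))

/-- The series with scalar coefficients `a` on `ℝ`, as a formal multilinear series. -/
noncomputable def coeffSeries (a : ℕ → ℂ) : FormalMultilinearSeries ℝ ℝ ℂ :=
  fun n => ContinuousMultilinearMap.mkPiRing ℝ (Fin n) (a n)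

theorem coeffSeries_coeff (a : ℕ → ℂ) (n : ℕ) : (coeffSeries a).coeff n = a n := by
  simp [coeffSeries, FormalMultilinearSeries.coeff]

theorem hasFPowerSeriesAt_coeffSeries {a : ℕ → ℂ} {f : ℝ → ℂ}
    (h : ∀ᶠ x : ℝ in nhds 0, HasSum (fun k : ℕ => a k * (x : ℂ) ^ k) (f x)) :
    HasFPowerSeriesAt f (coeffSeries a) 0 := by
  rw [hasFPowerSeriesAt_iff]
  filter_upwards [h] with x hx
  simpa [coeffSeries_coeff, mul_comm] using hx

theorem coeff_eq_of_hasSum {a b : ℕ → ℂ} {f : ℝ → ℂ}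
    (ha : ∀ᶠ x : ℝ in nhds 0, HasSum (fun k : ℕ => a k * (x : ℂ) ^ k) (f x))
    (hb : ∀ᶠ x : ℝ in nhds 0, HasSum (fun k : ℕ => b k * (x : ℂ) ^ k) (f x)) (n : ℕ) :
    a n = b n := by
  have h := (hasFPowerSeriesAt_coeffSeries ha).eq_formalMultilinearSeries
    (hasFPowerSeriesAt_coeffSeries hb)
  rw [← coeffSeries_coeff a, h, coeffSeries_coeff]

theorem hasSum_deriv_of_hasSum {a : ℕ → ℂ} {f : ℝ → ℂ}
    (h : ∀ᶠ x : ℝ in nhds 0, HasSum (fun k : ℕ => a k * (x : ℂ) ^ k) (f x)) :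
    ∀ᶠ x : ℝ in nhds 0,
      HasSum (fun k : ℕ => ((k + 1 : ℂ) * a (k + 1)) * (x : ℂ) ^ k) (deriv f x) := by
  obtain ⟨r, hr⟩ := hasFPowerSeriesAt_coeffSeries h
  filter_upwards [hr.fderiv.hasFPowerSeriesAt.eventually_hasSum] with x hx
  have hx1 := (ContinuousLinearMap.apply ℝ ℂ (1 : ℝ)).hasSum hx
  simp only [FormalMultilinearSeries.apply_eq_pow_smul_coeff, zero_add, map_smul,
    ContinuousLinearMap.apply_apply, FormalMultilinearSeries.derivSeries_coeff_one,
    coeffSeries_coeff, fderiv_apply_one_eq_deriv] at hx1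
  convert! hx1 using 2 with k
  simp
  ring

theorem hasSum_mul_var {a : ℕ → ℂ} {z s : ℂ} (h : HasSum (fun k : ℕ => a k * z ^ k) s) :
    HasSum (fun k : ℕ => (if k = 0 then 0 else a (k - 1)) * z ^ k) (z * s) := by
  rw [← hasSum_nat_add_iff' 1]
  convert! h.mul_left z using 1
  · ext k
    simp
    ring
  · simp

theorem hasDerivAt_GFun (ν : ℝ) (lam : ℂ) {x : ℝ} (hx : |x| < 1) :
    HasDerivAt (GFun ν lam)
      ((ν * x + 2 * Complex.I * lam) / (1 - x ^ 2) * GFun ν lam x) x := by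
  obtain ⟨hl, hu⟩ := abs_lt.1 hx
  have h1 : 0 < 1 + x := by linarith
  have h2 : 0 < 1 - x := by linarith
  have h3 : 0 < 1 - x ^ 2 := by nlinarith
  have hpow : HasDerivAt (fun y : ℝ => (1 - y ^ 2) ^ (-ν / 2))
      (ν * x / (1 - x ^ 2) * (1 - x ^ 2) ^ (-ν / 2)) x := by
    have h := (((hasDerivAt_id x).pow 2).const_sub 1).rpow_const (p := -ν / 2) (Or.inl h3.ne')
    convert! h using 1
    simp only [id, Pi.pow_apply]
    rw [Real.rpow_sub_one h3.ne']
    field_simp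
    simp
    ring
  have hlog : HasDerivAt (fun y : ℝ => Real.log ((1 + y) / (1 - y))) (2 / (1 - x ^ 2)) x := by
    have h := ((((hasDerivAt_id x).const_add 1).div ((hasDerivAt_id x).const_sub 1)
      h2.ne').log (div_pos h1 h2).ne')
    convert! h using 1
    have h4 : 1 - x ^ 2 = (1 + x) * (1 - x) := by ring
    simp only [id, Pi.div_apply]
    rw [h4]
    field_simp
    ring
  have h := hpow.ofReal_comp.mul ((hlog.ofReal_comp.const_mul (Complex.I * lam)).cexp)
  convert! h using 1
  simp only [GFun]
  push_cast
  ring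

theorem meixner_pollaczek_recurrence (ν : ℝ) (hν : 0 < ν) (lam : ℂ) (n : ℕ) (hn : 1 ≤ n)
    (p : ℕ → ℂ)
    (hp : ∃ r > 0, ∀ x : ℝ, |x| < r →
      HasSum (fun k : ℕ => p k * (x : ℂ) ^ k) (GFun ν lam x)) :
    2 * Complex.I * lam * p n =
      (n + 1) * p (n + 1) - ((ν : ℂ) + n - 1) * p (n - 1) := by
  obtain ⟨r, hr, hp⟩ := hp
  have hball : ∀ {ε : ℝ}, 0 < ε → ∀ᶠ x : ℝ in nhds 0, |x| < ε := fun hε => by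
    filter_upwards [Metric.ball_mem_nhds (0 : ℝ) hε] with x hx using by simpa using hx
  have hG : ∀ᶠ x : ℝ in nhds 0, HasSum (fun k : ℕ => p k * (x : ℂ) ^ k) (GFun ν lam x) :=
    (hball hr).mono hp
  have hD := hasSum_deriv_of_hasSum hG
  have key := coeff_eq_of_hasSum
    (a := fun k => 2 * Complex.I * lam * p k + ν * (if k = 0 then 0 else p (k - 1)))
    (f := fun x => 2 * Complex.I * lam * GFun ν lam x + ν * (x * GFun ν lam x))
    (b := fun k => (k + 1 : ℂ) * p (k + 1) - (if k = 0 then 0 else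
      if k - 1 = 0 then 0 else (((k - 1 - 1 : ℕ) : ℂ) + 1) * p (k - 1 - 1 + 1)))
    (by
      filter_upwards [hG] with x hx
      convert! (hx.mul_left (2 * Complex.I * lam)).add ((hasSum_mul_var hx).mul_left (ν : ℂ))
        using 2
      ring)
    (by
      filter_upwards [hD, hball one_pos] with x hx hx1
      have hne : (1 - (x : ℂ) ^ 2) ≠ 0 := by
        have : 0 < 1 - x ^ 2 := by nlinarith [abs_lt.1 hx1]
        exact_mod_cast this.ne'
      convert! hx.sub (hasSum_mul_var (hasSum_mul_var hx)) using 1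
      · ext k
        ring
      · rw [(hasDerivAt_GFun ν lam hx1).deriv]
        field_simp
        ring) n
  obtain ⟨m, rfl⟩ := Nat.exists_eq_add_of_le' hn
  rcases m with _ | m
  · simp at key ⊢
    linear_combination key
  · simp at key ⊢
    linear_combination key
end

section
/- For every real ν > 0 and every real y with |y| < 1, the Berezin kernel has constant integral against the invariant measure: ∫_{−1}^1 (1−x²)^{ν/2 − 1} (1−y²)^{ν/2} (1−xy)^{−ν} dx = ∫_{−1}^1 (1−u²)^{ν/2 − 1} du, and both integrals are finite. -/
open MeasureTheory Set

/-- For `a > -1` the weight `(1 - u²) ^ a` is integrable over `(-1, 1)`. -/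
lemma integrableOn_one_sub_sq_rpow {a : ℝ} (ha : -1 < a) :
    IntegrableOn (fun u : ℝ => (1 - u ^ 2) ^ a) (Ioo (-1 : ℝ) 1) volume := by
  have right : IntervalIntegrable (fun u : ℝ => (1 - u ^ 2) ^ a) volume 0 1 := by
    have singular : IntervalIntegrable (fun u : ℝ => (1 - u) ^ a) volume 0 1 := by
      simpa using ((intervalIntegral.intervalIntegrable_rpow' ha (a := 0) (b := 1)).comp_sub_left
        1).symm
    have regular : ContinuousOn (fun u : ℝ => (1 + u) ^ a) (uIcc 0 1) := by
      refine ContinuousOn.rpow_const (by fun_prop) fun u hu => Or.inl ?_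
      rw [uIcc_of_le zero_le_one] at hu
      linarith [hu.1]
    refine (singular.mul_continuousOn regular).congr fun u hu => ?_
    rw [uIoc_of_le zero_le_one] at hu
    rw [← Real.mul_rpow (by linarith [hu.2]) (by linarith [hu.1])]
    ring_nf
  have left : IntervalIntegrable (fun u : ℝ => (1 - u ^ 2) ^ a) volume (-1) 0 := by
    rw [IntervalIntegrable.iff_comp_neg]
    simpa using right.symm
  exact (intervalIntegrable_iff_integrableOn_Ioo_of_le (by norm_num)).1 (left.trans right)

lemma one_sub_mul_pos {x y : ℝ} (hx : x ∈ Ioo (-1 : ℝ) 1) (hy : y ∈ Ioo (-1 : ℝ) 1) :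
    0 < 1 - x * y := by
  nlinarith [mul_pos (sub_pos.2 hx.2) (neg_lt_iff_pos_add.1 hy.1),
    mul_pos (sub_pos.2 hy.2) (neg_lt_iff_pos_add.1 hx.1)]

lemma one_sub_sq_pos {x : ℝ} (hx : x ∈ Ioo (-1 : ℝ) 1) : 0 < 1 - x ^ 2 := by
  nlinarith [one_sub_mul_pos hx hx]

/-- The Möbius transformation of `(-1, 1)` taking `y` to `0`. -/
noncomputable def moebius (y x : ℝ) : ℝ := (x - y) / (1 - x * y)

lemma one_sub_moebius_sq {x y : ℝ} (h : 1 - x * y ≠ 0) :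
    1 - moebius y x ^ 2 = (1 - x ^ 2) * (1 - y ^ 2) / (1 - x * y) ^ 2 := by
  unfold moebius
  field_simp
  ring

lemma moebius_mem_Ioo {x y : ℝ} (hx : x ∈ Ioo (-1 : ℝ) 1) (hy : y ∈ Ioo (-1 : ℝ) 1) :
    moebius y x ∈ Ioo (-1 : ℝ) 1 := by
  have h : 0 < 1 - moebius y x ^ 2 := by
    rw [one_sub_moebius_sq (one_sub_mul_pos hx hy).ne']
    exact div_pos (mul_pos (one_sub_sq_pos hx) (one_sub_sq_pos hy))
      (pow_pos (one_sub_mul_pos hx hy) 2)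
  rw [mem_Ioo, ← abs_lt, ← sq_lt_one_iff_abs_lt_one]
  linarith

lemma moebius_neg_moebius {x y : ℝ} (hx : x ∈ Ioo (-1 : ℝ) 1) (hy : y ∈ Ioo (-1 : ℝ) 1) :
    moebius (-y) (moebius y x) = x := by
  have h := (one_sub_mul_pos hx hy).ne'
  have h' := (one_sub_sq_pos hy).ne'
  have hden : 1 - moebius y x * -y = (1 - y ^ 2) / (1 - x * y) := by
    unfold moebius
    field_simp
    ring
  have hnum : moebius y x - -y = x * ((1 - y ^ 2) / (1 - x * y)) := by
    unfold moebius
    field_simp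
    ring
  rw [moebius, hden, hnum, mul_div_cancel_right₀ _ (div_ne_zero h' h)]

lemma injOn_moebius {y : ℝ} (hy : y ∈ Ioo (-1 : ℝ) 1) :
    InjOn (moebius y) (Ioo (-1 : ℝ) 1) :=
  LeftInvOn.injOn (f₁' := moebius (-y)) fun _ hx => moebius_neg_moebius hx hy

lemma image_moebius {y : ℝ} (hy : y ∈ Ioo (-1 : ℝ) 1) :
    moebius y '' Ioo (-1 : ℝ) 1 = Ioo (-1 : ℝ) 1 := by
  have hy' : -y ∈ Ioo (-1 : ℝ) 1 := ⟨by linarith [hy.2], by linarith [hy.1]⟩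
  refine Subset.antisymm (image_subset_iff.2 fun x hx => moebius_mem_Ioo hx hy) fun x hx =>
    ⟨moebius (-y) x, moebius_mem_Ioo hx hy', ?_⟩
  simpa using moebius_neg_moebius hx hy'

lemma hasDerivAt_moebius {x y : ℝ} (h : 1 - x * y ≠ 0) :
    HasDerivAt (moebius y) ((1 - y ^ 2) / (1 - x * y) ^ 2) x := by
  convert! ((hasDerivAt_id x).sub_const y).div
    (((hasDerivAt_id x).mul_const y).const_sub 1) h using 1
  simp only [id_eq]
  ring

/-- The Berezin kernel is the pullback of the weight under the Möbius transformation. -/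
lemma abs_deriv_moebius_smul_rpow (ν : ℝ) {x y : ℝ} (hx : x ∈ Ioo (-1 : ℝ) 1)
    (hy : y ∈ Ioo (-1 : ℝ) 1) :
    |(1 - y ^ 2) / (1 - x * y) ^ 2| • (1 - moebius y x ^ 2) ^ (ν / 2 - 1) =
      (1 - x ^ 2) ^ (ν / 2 - 1) * (1 - y ^ 2) ^ (ν / 2) * (1 - x * y) ^ (-ν) := by
  have h := one_sub_mul_pos hx hy
  have hx' := one_sub_sq_pos hx
  have hy' := one_sub_sq_pos hy
  have hpow : ((1 - x * y) ^ 2) ^ (ν / 2 - 1) = (1 - x * y) ^ ν / (1 - x * y) ^ 2 := by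
    rw [← Real.rpow_natCast, ← Real.rpow_mul h.le, ← Real.rpow_sub h]
    congr 1
    push_cast
    ring
  rw [one_sub_moebius_sq h.ne', abs_of_pos (by positivity), smul_eq_mul,
    Real.div_rpow (by positivity) (by positivity), Real.mul_rpow hx'.le hy'.le, hpow,
    Real.rpow_sub_one hy'.ne', Real.rpow_neg h.le]
  generalize 1 - x * y = d at *
  field_simp

theorem berezin_kernel_constant_integral (ν : ℝ) (hν : 0 < ν) (y : ℝ) (hy : |y| < 1) :
    IntegrableOn (fun x : ℝ =>
        (1 - x ^ 2) ^ (ν / 2 - 1) * (1 - y ^ 2) ^ (ν / 2) * (1 - x * y) ^ (-ν))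
      (Ioo (-1 : ℝ) 1) volume ∧
    IntegrableOn (fun u : ℝ => (1 - u ^ 2) ^ (ν / 2 - 1)) (Ioo (-1 : ℝ) 1) volume ∧
    ∫ x in Ioo (-1 : ℝ) 1,
        (1 - x ^ 2) ^ (ν / 2 - 1) * (1 - y ^ 2) ^ (ν / 2) * (1 - x * y) ^ (-ν) =
      ∫ u in Ioo (-1 : ℝ) 1, (1 - u ^ 2) ^ (ν / 2 - 1) := by
  replace hy : y ∈ Ioo (-1 : ℝ) 1 := abs_lt.1 hy
  have weight := integrableOn_one_sub_sq_rpow (a := ν / 2 - 1) (by linarith)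
  have deriv : ∀ x ∈ Ioo (-1 : ℝ) 1, HasDerivWithinAt (moebius y)
      ((1 - y ^ 2) / (1 - x * y) ^ 2) (Ioo (-1 : ℝ) 1) x := fun x hx =>
    (hasDerivAt_moebius (one_sub_mul_pos hx hy).ne').hasDerivWithinAt
  refine ⟨?_, weight, ?_⟩
  · have := (integrableOn_image_iff_integrableOn_abs_deriv_smul measurableSet_Ioo deriv
      (injOn_moebius hy) fun u => (1 - u ^ 2) ^ (ν / 2 - 1)).1 (by rwa [image_moebius hy])
    exact this.congr_fun (fun x hx => abs_deriv_moebius_smul_rpow ν hx hy) measurableSet_Ioo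
  · have := integral_image_eq_integral_abs_deriv_smul measurableSet_Ioo deriv
      (injOn_moebius hy) fun u => (1 - u ^ 2) ^ (ν / 2 - 1)
    rw [image_moebius hy] at this
    rw [this]
    exact setIntegral_congr_fun measurableSet_Ioo
      fun x hx => (abs_deriv_moebius_smul_rpow ν hx hy).symm
end

section
/- For every real ν > 0, every integer n ≥ 1, and every real t > 0, the Laguerre functions ℓ_n^ν(t) = e^{−t} L_n^{ν−1}(2t) satisfy the lowering relation t · (ℓ_n^ν)''(t) + (2t + ν) · (ℓ_n^ν)'(t) + (t + ν) · ℓ_n^ν(t) = −2(n + ν − 1) · ℓ_{n−1}^ν(t). -/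
/-- The Laguerre function with parameter `ν`: `ℓ_n^ν(t) = e^{−t} L_n^{ν−1}(2t)`. -/
noncomputable def laguerreEll (ν : ℝ) (n : ℕ) (t : ℝ) : ℝ :=
  Real.exp (-t) * laguerreL (ν - 1) n (2 * t)

open Polynomial in
/-- The Laguerre polynomial `laguerreL α n` as an element of `ℝ[X]`. -/
noncomputable def laguerrePolynomial (α : ℝ) (n : ℕ) : ℝ[X] :=
  ∑ k ∈ Finset.range (n + 1),
    C (Real.Gamma (n + α + 1) / Real.Gamma (k + α + 1) * (-1) ^ k /
      (Nat.factorial k * Nat.factorial (n - k))) * X ^ k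

theorem eval_laguerrePolynomial (α : ℝ) (n : ℕ) (x : ℝ) :
    (laguerrePolynomial α n).eval x = laguerreL α n x := by
  rw [laguerrePolynomial, laguerreL, Polynomial.eval_finsetSum]
  refine Finset.sum_congr rfl fun k _ => ?_
  rw [Polynomial.eval_mul, Polynomial.eval_C, Polynomial.eval_pow, Polynomial.eval_X, neg_pow x]
  ring

open Polynomial in
theorem X_mul_derivative_two_add_derivative_C_mul_X_pow_succ (a c : ℝ) (k : ℕ) :
    X * derivative (derivative (C c * X ^ (k + 1))) + C a * derivative (C c * X ^ (k + 1)) =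
      C (c * (k + 1) * (k + a)) * X ^ k := by
  cases k with
  | zero => simp; ring
  | succ k =>
    simp only [derivative_C, derivative_X_pow_succ, C_mul, C_add, C_1, map_natCast,
      Nat.cast_add, Nat.cast_one, derivative_mul, derivative_add, derivative_natCast,
      derivative_one, zero_mul, zero_add, add_zero]
    ring

open Polynomial in
/-- The lowering relation `x L'' + (α + 1) L' = -(n + 1 + α) L_n^α` for `L = L_{n+1}^α`. -/
theorem laguerrePolynomial_lowering {α : ℝ} (hα : -1 < α) (n : ℕ) :
    X * derivative (derivative (laguerrePolynomial α (n + 1))) +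
        C (α + 1) * derivative (laguerrePolynomial α (n + 1)) =
      C (-(n + 1 + α)) * laguerrePolynomial α n := by
  simp only [laguerrePolynomial]
  rw [Finset.sum_range_succ']
  simp only [pow_zero, mul_one, derivative_add, derivative_C, add_zero, derivative_sum]
  rw [Finset.mul_sum, Finset.mul_sum, Finset.mul_sum, ← Finset.sum_add_distrib]
  refine Finset.sum_congr rfl fun k _ => ?_
  rw [X_mul_derivative_two_add_derivative_C_mul_X_pow_succ, ← mul_assoc, ← C_mul]
  congr 2
  have hk : (0 : ℝ) < k + α + 1 := by linarith [k.cast_nonneg (α := ℝ)]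
  have hn : (0 : ℝ) < n + α + 1 := by linarith [n.cast_nonneg (α := ℝ)]
  have hΓ := (Real.Gamma_pos_of_pos hk).ne'
  have hk₁ : Real.Gamma (((k + 1 : ℕ) : ℝ) + α + 1) =
      (k + α + 1) * Real.Gamma (k + α + 1) := by
    rw [← Real.Gamma_add_one hk.ne']; push_cast; ring_nf
  have hn₁ : Real.Gamma (((n + 1 : ℕ) : ℝ) + α + 1) =
      (n + α + 1) * Real.Gamma (n + α + 1) := by
    rw [← Real.Gamma_add_one hn.ne']; push_cast; ring_nf
  have hk₀ := hk.ne'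
  have hf := Nat.factorial_ne_zero k
  have hg := Nat.factorial_ne_zero (n - k)
  rw [hk₁, hn₁, Nat.add_sub_add_right, Nat.factorial_succ]
  push_cast
  have hk₂ : (k : ℝ) + 1 ≠ 0 := by positivity
  field_simp
  ring

theorem deriv_exp_neg_mul_eval_two_mul (p : Polynomial ℝ) :
    deriv (fun t => Real.exp (-t) * p.eval (2 * t)) =
      fun t => Real.exp (-t) * (2 * p.derivative - p).eval (2 * t) := by
  funext t
  have h₁ : HasDerivAt (fun t : ℝ => Real.exp (-t)) (Real.exp (-t) * -1) t :=
    (hasDerivAt_neg t).exp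
  have h₂ : HasDerivAt (fun t : ℝ => p.eval (2 * t)) (p.derivative.eval (2 * t) * (2 * 1)) t :=
    (p.hasDerivAt (2 * t)).comp t ((hasDerivAt_id t).const_mul 2)
  rw [(h₁.fun_mul h₂).deriv]
  simp only [Polynomial.eval_sub, Polynomial.eval_mul, Polynomial.eval_ofNat]
  ring

theorem laguerreEll_lowering (ν : ℝ) (hν : 0 < ν) (n : ℕ) (hn : 1 ≤ n) (t : ℝ) (ht : 0 < t) :
    t * deriv (deriv (laguerreEll ν n)) t + (2 * t + ν) * deriv (laguerreEll ν n) t +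
      (t + ν) * laguerreEll ν n t = -2 * (n + ν - 1) * laguerreEll ν (n - 1) t := by
  obtain ⟨m, rfl⟩ := Nat.exists_eq_add_of_le' hn
  have hell (k : ℕ) : laguerreEll ν k =
      fun t => Real.exp (-t) * (laguerrePolynomial (ν - 1) k).eval (2 * t) := by
    funext t
    rw [laguerreEll, eval_laguerrePolynomial]
  have key := congrArg (Polynomial.eval (2 * t))
    (laguerrePolynomial_lowering (α := ν - 1) (by linarith) m)
  rw [hell, hell, deriv_exp_neg_mul_eval_two_mul, deriv_exp_neg_mul_eval_two_mul,
    Nat.add_sub_cancel]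
  simp only [Polynomial.derivative_sub, Polynomial.derivative_mul, Polynomial.derivative_ofNat,
    zero_mul, zero_add, Polynomial.eval_sub, Polynomial.eval_add, Polynomial.eval_mul,
    Polynomial.eval_ofNat, Polynomial.eval_X, Polynomial.eval_C] at key ⊢
  push_cast
  linear_combination 2 * Real.exp (-t) * key
end
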